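/- Let d, n ≥ 1 be integers and let A and B be measurable subsets of the torus T^d of positive measure, and let b_1, …, b_n be chosen independently and uniformly at random from B. If |A| + |B| ≤ 1, then E(|⋃_{i=1}^n (A + b_i)|) ≥ |A| + ((n−1)/(n+1))·|B| − ((n−1)/(n+1))·|B|·(1 − |A|/|B|)^{n+1}·𝟙_{|A|<|B|}. If |A| + |B| > 1, then E(|⋃_{i=1}^n (A + b_i)|) ≥ 1 − ((1−|A|)/|B|)^n·(|B| − ((n−1)/(n+1))·(1−|A|)) − ((n−1)/(n+1))·|B|·(1 − |A|/|B|)^{n+1}·𝟙_{|A|<|B|}. Here 𝟙_{|A|<|B|} equals 1 if |A| < |B| and 0 otherwise. -/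

import Mathlib

open MeasureTheory

/-- The circle `ℝ/ℤ`. -/
abbrev 𝕋 := AddCircle (1 : ℝ)

/-- The expected (Haar) measure of `⋃ i, (A i + b i)` in the torus `𝕋^d`, where each `b i`
is chosen independently and uniformly at random from `B i`. -/
noncomputable def expUnionT {d n : ℕ} (A B : Fin n → Set (Fin d → 𝕋)) : ℝ :=
  ((∏ i, volume (B i))⁻¹ *
    ∫⁻ b in Set.univ.pi B, volume (⋃ i, (· + b i) '' (A i))).toReal

section Convolution

variable {G : Type*} [AddCommGroup G] [MeasurableSpace G]

/-- The convolution of the indicator functions of `A` and `B`. -/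
noncomputable def indConv (μ : Measure G) (A B : Set G) (x : G) : ℝ :=
  μ.real (B ∩ (fun b => x - b) ⁻¹' A)

variable {μ : Measure G} {A A' B : Set G}

lemma indConv_nonneg (x : G) : 0 ≤ indConv μ A B x := measureReal_nonneg

lemma indConv_add_preimage (z x : G) :
    indConv μ ((fun g => g + z) ⁻¹' A) B x = indConv μ A B (x + z) := by
  simp only [indConv]
  congr 2
  ext b
  simp [sub_add_eq_add_sub]

section Finite

variable [IsFiniteMeasure μ]

lemma indConv_le_right (x : G) : indConv μ A B x ≤ μ.real B :=
  measureReal_mono Set.inter_subset_left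

lemma indConv_mono (h : A ⊆ A') (x : G) : indConv μ A B x ≤ indConv μ A' B x :=
  measureReal_mono (Set.inter_subset_inter_right _ (Set.preimage_mono h))

end Finite

lemma measurableSet_sub_preimage [MeasurableAdd G] [MeasurableNeg G] (hA : MeasurableSet A) (x : G) :
    MeasurableSet ((fun b => x - b) ⁻¹' A) := by
  simp only [sub_eq_add_neg]
  exact (measurable_neg.const_add x) hA

section Negation

variable [MeasurableAdd G] [MeasurableNeg G] [μ.IsAddLeftInvariant] [μ.IsNegInvariant]

lemma measureReal_sub_preimage (hA : MeasurableSet A) (x : G) :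
    μ.real ((fun b => x - b) ⁻¹' A) = μ.real A := by
  simp only [measureReal_def]
  rw [(Measure.measurePreserving_sub_left μ x).measure_preimage hA.nullMeasurableSet]

variable [IsProbabilityMeasure μ]

lemma indConv_le_left (hA : MeasurableSet A) (x : G) : indConv μ A B x ≤ μ.real A :=
  (measureReal_mono Set.inter_subset_right).trans (measureReal_sub_preimage hA x).le

lemma add_sub_one_le_indConv (hA : MeasurableSet A) (x : G) :
    μ.real A + μ.real B - 1 ≤ indConv μ A B x := by
  have h := measureReal_union_add_inter (μ := μ) (s := B) (measurableSet_sub_preimage hA x)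
  rw [measureReal_sub_preimage hA] at h
  have h1 : μ.real (B ∪ (fun b => x - b) ⁻¹' A) ≤ 1 := measureReal_le_one
  simp only [indConv]
  linarith

end Negation

/-- The integral of the convolution of the indicators of `A` and `B` truncated at `t`. -/
noncomputable def truncConv (μ : Measure G) (t : ℝ) (A B : Set G) : ℝ :=
  ∫ x, min (indConv μ A B x) t ∂μ

lemma truncConv_add_preimage [MeasurableAdd G] [μ.IsAddLeftInvariant] (z : G) (t : ℝ) :
    truncConv μ t ((fun g => g + z) ⁻¹' A) B = truncConv μ t A B := by
  simp only [truncConv, indConv_add_preimage]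
  exact integral_add_right_eq_self (fun x => min (indConv μ A B x) t) z

variable [MeasurableAdd₂ G] [MeasurableNeg G] [IsProbabilityMeasure μ]

lemma indConv_union_add_inter (hA' : MeasurableSet A') (hB : MeasurableSet B) (x : G) :
    indConv μ (A ∪ A') B x + indConv μ (A ∩ A') B x = indConv μ A B x + indConv μ A' B x := by
  have h := measureReal_union_add_inter (μ := μ) (s := B ∩ (fun b => x - b) ⁻¹' A)
    (hB.inter (measurableSet_sub_preimage hA' x))
  rwa [← Set.inter_union_distrib_left, ← Set.inter_inter_distrib_left] at h

lemma measurable_indConv (hA : MeasurableSet A) (hB : MeasurableSet B) :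
    Measurable (indConv μ A B) := by
  have h : MeasurableSet {p : G × G | p.2 ∈ B ∧ p.1 - p.2 ∈ A} :=
    (measurable_snd hB).inter ((measurable_fst.sub measurable_snd) hA)
  exact (measurable_measure_prodMk_left (ν := μ) h).ennreal_toReal

lemma integrable_indConv (hA : MeasurableSet A) (hB : MeasurableSet B) :
    Integrable (indConv μ A B) μ :=
  Integrable.of_bound (measurable_indConv hA hB).aestronglyMeasurable 1
    (.of_forall fun x => by
      rw [Real.norm_of_nonneg (indConv_nonneg x)]; exact measureReal_le_one)

lemma integral_indConv [μ.IsAddLeftInvariant] (hA : MeasurableSet A) (hB : MeasurableSet B) :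
    ∫ x, indConv μ A B x ∂μ = μ.real A * μ.real B := by
  have h : MeasurableSet {p : G × G | p.2 ∈ B ∧ p.1 - p.2 ∈ A} :=
    (measurable_snd hB).inter ((measurable_fst.sub measurable_snd) hA)
  have key : ∫⁻ x, μ (B ∩ (fun b => x - b) ⁻¹' A) ∂μ = μ A * μ B := by
    have h1 := Measure.prod_apply (μ := μ) (ν := μ) h
    rw [Measure.prod_apply_symm h] at h1
    refine h1.symm.trans ?_
    have h2 : ∀ y, μ ((fun x => (x, y)) ⁻¹' {p : G × G | p.2 ∈ B ∧ p.1 - p.2 ∈ A}) =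
        B.indicator (fun _ => μ A) y := by
      intro y
      by_cases hy : y ∈ B
      · have : ((fun x => (x, y)) ⁻¹' {p : G × G | p.2 ∈ B ∧ p.1 - p.2 ∈ A}) =
          (fun x => x + -y) ⁻¹' A := by ext; simp [hy, sub_eq_add_neg]
        rw [this, measure_preimage_add_right, Set.indicator_of_mem hy]
      · simp [hy]
    simp_rw [h2]
    rw [lintegral_indicator hB]
    simp
  simp only [indConv, measureReal_def]
  rw [integral_toReal, key, ENNReal.toReal_mul]
  · exact (measurable_measure_prodMk_left (ν := μ) h).aemeasurable
  · exact .of_forall fun x => measure_lt_top _ _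

lemma integrable_min_indConv (hA : MeasurableSet A) (hB : MeasurableSet B) (t : ℝ) :
    Integrable (fun x => min (indConv μ A B x) t) μ :=
  (integrable_indConv hA hB).inf (integrable_const t)

lemma truncConv_union_add_inter_le (hA : MeasurableSet A) (hA' : MeasurableSet A')
    (hB : MeasurableSet B) (t : ℝ) :
    truncConv μ t (A ∪ A') B + truncConv μ t (A ∩ A') B ≤
      truncConv μ t A B + truncConv μ t A' B := by
  simp only [truncConv]
  rw [← integral_add (integrable_min_indConv (hA.union hA') hB t)
      (integrable_min_indConv (hA.inter hA') hB t),
    ← integral_add (integrable_min_indConv hA hB t) (integrable_min_indConv hA' hB t)]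
  refine integral_mono
    ((integrable_min_indConv (hA.union hA') hB t).add (integrable_min_indConv (hA.inter hA') hB t))
    ((integrable_min_indConv hA hB t).add (integrable_min_indConv hA' hB t)) fun x => ?_
  have h := indConv_union_add_inter (μ := μ) (A := A) hA' hB x
  have h1 := indConv_mono (μ := μ) (B := B) (Set.inter_subset_left (s := A) (t := A')) x
  have h2 := indConv_mono (μ := μ) (B := B) (Set.inter_subset_right (s := A) (t := A')) x
  grind

variable [μ.IsAddLeftInvariant] [μ.IsNegInvariant]

lemma truncConv_of_le_left {t : ℝ} (hA : MeasurableSet A) (hB : MeasurableSet B)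
    (h : μ.real A ≤ t) : truncConv μ t A B = μ.real A * μ.real B := by
  rw [← integral_indConv hA hB]
  exact integral_congr_ae (.of_forall fun x => min_eq_left ((indConv_le_left hA x).trans h))

lemma truncConv_of_le_add_sub_one {t : ℝ} (hA : MeasurableSet A)
    (h : t ≤ μ.real A + μ.real B - 1) : truncConv μ t A B = t := by
  have : ∀ x, min (indConv μ A B x) t = t := fun x =>
    min_eq_right (h.trans (add_sub_one_le_indConv hA x))
  simp [truncConv, this]

end Convolution

section Pollard

variable {G : Type*} [AddCommGroup G] [TopologicalSpace G] [IsTopologicalAddGroup G]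
  [R1Space G] [MeasurableSpace G] [BorelSpace G]
  {μ : Measure G} [IsProbabilityMeasure μ] [μ.IsAddLeftInvariant] [μ.InnerRegularCompactLTTop]
  {A B : Set G}

lemma continuous_measureReal_inter_add_preimage (hA : MeasurableSet A) :
    Continuous fun z => μ.real (A ∩ (fun g => g + z) ⁻¹' A) := by
  rw [continuous_iff_continuousAt]
  intro z₀
  have hc : Continuous ((ContinuousMap.mk (fun a : G × G ↦ a.2 + a.1)
    (continuous_snd.add continuous_fst)).curry : G → C(G, G)) := ContinuousMap.continuous _
  have h := tendsto_measure_symmDiff_preimage_nhds_zero (μ := μ) (ν := μ) (s := A)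
    (hc.tendsto z₀) (.of_forall fun z => measurePreserving_add_right μ z)
    (measurePreserving_add_right μ z₀) hA.nullMeasurableSet (measure_ne_top _ _)
  have h' := (ENNReal.tendsto_toReal ENNReal.zero_ne_top).comp h
  refine tendsto_iff_norm_sub_tendsto_zero.2 (squeeze_zero (fun _ => norm_nonneg _) (fun z => ?_) h')
  have hm : ∀ z, MeasurableSet ((fun g => g + z) ⁻¹' A) := fun z => (measurable_add_const z) hA
  refine (abs_measureReal_sub_le_measureReal_symmDiff (hA.inter (hm z)).nullMeasurableSet
    (hA.inter (hm z₀)).nullMeasurableSet).trans ?_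
  refine measureReal_mono (μ := μ) ?_
  rw [← Set.inter_symmDiff_distrib_left]
  exact Set.inter_subset_right

variable [SecondCountableTopology G] [ConnectedSpace G] [μ.IsNegInvariant]

lemma exists_measureReal_inter_add_preimage_eq (hA : MeasurableSet A) {s : ℝ}
    (hs : μ.real A * μ.real A ≤ s) (hs' : s ≤ μ.real A) :
    ∃ z, μ.real (A ∩ (fun g => g + z) ⁻¹' A) = s := by
  have hcont := continuous_measureReal_inter_add_preimage (μ := μ) hA
  have hnA : MeasurableSet (-A) := measurable_neg hA
  have heq : ∀ z, indConv μ A (-A) z = μ.real (A ∩ (fun g => g + z) ⁻¹' A) := fun z => by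
    simp only [indConv, measureReal_def]
    rw [← Measure.measure_preimage_neg]
    congr 2
    ext g
    simp [add_comm]
  obtain ⟨z₀, hz₀⟩ := exists_le_integral (integrable_indConv (μ := μ) hA hnA)
  rw [integral_indConv hA hnA, heq, measureReal_def (s := -A), Measure.measure_neg] at hz₀
  exact mem_range_of_exists_le_of_exists_ge hcont ⟨z₀, hz₀.trans hs⟩ ⟨0, by simpa using hs'⟩

lemma le_truncConv_sub_of_pow_le {t m : ℝ} (ht : 0 ≤ t) (hm : m ≤ 0) (hB : MeasurableSet B)
    (hlow : ∀ A, MeasurableSet A → t ≤ μ.real A → μ.real A ≤ 1 - μ.real B + t →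
      m ≤ truncConv μ t A B - t * (μ.real A + μ.real B - t)) (k : ℕ) :
    ∀ A, MeasurableSet A → t ≤ μ.real A → μ.real A ≤ 1 - μ.real B + t →
      μ.real A ^ 2 ^ k ≤ t →
      (1 - (1 / 2) ^ k) * m ≤ truncConv μ t A B - t * (μ.real A + μ.real B - t) := by
  induction k with
  | zero =>
    intro A hA h1 h2 h3
    simp only [pow_zero, pow_one] at h3
    have h4 := le_antisymm h3 h1
    rw [truncConv_of_le_left hA hB h3, h4]
    simp
  | succ k ih =>
    intro A hA h1 h2 h3
    have hp : (0 : ℝ) ≤ (1 / 2) ^ k := by positivity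
    have hA1 : μ.real A ≤ 1 := measureReal_le_one
    have hA0 : 0 ≤ μ.real A := measureReal_nonneg
    obtain ⟨z, hz⟩ := exists_measureReal_inter_add_preimage_eq (μ := μ) hA
      (s := max (max t (μ.real A * μ.real A)) (2 * μ.real A - (1 - μ.real B + t)))
      (le_max_of_le_left (le_max_right _ _))
      (max_le (max_le h1 (by nlinarith)) (by linarith))
    have hA' : MeasurableSet ((fun g => g + z) ⁻¹' A) := (measurable_add_const z) hA
    have hsum := measureReal_union_add_inter (μ := μ) (s := A) hA'
    have hsub := truncConv_union_add_inter_le (μ := μ) hA hA' hB t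
    rw [truncConv_add_preimage] at hsub
    have hinv : μ.real ((fun g => g + z) ⁻¹' A) = μ.real A := by
      simp only [measureReal_def, measure_preimage_add_right]
    rw [hinv] at hsum
    set I := A ∩ (fun g => g + z) ⁻¹' A
    set U := A ∪ (fun g => g + z) ⁻¹' A
    have hI : MeasurableSet I := hA.inter hA'
    have hU : MeasurableSet U := hA.union hA'
    have hIA : μ.real I ≤ μ.real A := measureReal_mono Set.inter_subset_left
    have hAU : μ.real A ≤ μ.real U := measureReal_mono Set.subset_union_left
    have hIt : t ≤ μ.real I := hz ▸ le_max_of_le_left (le_max_left _ _)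
    have hUc : μ.real U ≤ 1 - μ.real B + t := by
      have := hz ▸ le_max_right (max t (μ.real A * μ.real A))
        (2 * μ.real A - (1 - μ.real B + t))
      linarith
    have hlI := hlow I hI hIt (hIA.trans h2)
    have hlU := hlow U hU (h1.trans hAU) hUc
    have hlin : t * (μ.real U + μ.real B - t) + t * (μ.real I + μ.real B - t) =
        2 * (t * (μ.real A + μ.real B - t)) := by linear_combination t * hsum
    rw [pow_succ]
    by_cases hcase : μ.real I ^ 2 ^ k ≤ t
    · have := ih I hI hIt (hIA.trans h2) hcase
      linarith
    · have hIeq : μ.real I = 2 * μ.real A - (1 - μ.real B + t) := by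
        rcases max_choice (max t (μ.real A * μ.real A)) (2 * μ.real A - (1 - μ.real B + t))
          with h | h
        · exfalso
          apply hcase
          rw [hz, h]
          rcases max_choice t (μ.real A * μ.real A) with h' | h'
          · rw [h']
            exact pow_le_of_le_one ht (h1.trans hA1) (by positivity)
          · rw [h', ← sq, ← pow_mul, ← pow_succ']
            exact h3
        · rw [hz, h]
      have hUeq : μ.real U = 1 - μ.real B + t := by linarith
      have : truncConv μ t U B = t := truncConv_of_le_add_sub_one hU (by linarith)
      rw [this] at hsub
      rw [hUeq] at hlin
      have hp1 : (1 / 2 : ℝ) ^ k ≤ 1 := pow_le_one₀ (by norm_num) (by norm_num)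
      nlinarith [mul_nonneg (sub_nonneg.2 hp1) (neg_nonneg.2 hm)]

/-- Pollard's inequality in a compact connected abelian group. -/
theorem mul_min_le_truncConv {t : ℝ} (hA : MeasurableSet A) (hB : MeasurableSet B) (ht : 0 ≤ t)
    (htA : t ≤ μ.real A) (htB : t ≤ μ.real B) :
    t * min (μ.real A + μ.real B - t) 1 ≤ truncConv μ t A B := by
  rcases le_total (1 - μ.real B + t) (μ.real A) with hc | hc
  · rw [truncConv_of_le_add_sub_one hA (by linarith)]
    exact mul_le_of_le_one_right ht (min_le_right _ _)
  refine (mul_le_mul_of_nonneg_left (min_le_left _ _) ht).trans ?_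
  have hB1 : μ.real B ≤ 1 := measureReal_le_one
  rcases ht.eq_or_lt with rfl | ht
  · rw [zero_mul]
    exact integral_nonneg fun x => le_min (indConv_nonneg x) le_rfl
  rcases htB.eq_or_lt with rfl | htB
  · have : ∀ x, min (indConv μ A B x) (μ.real B) = indConv μ A B x := fun x =>
      min_eq_left (indConv_le_right x)
    simp only [truncConv, this]
    rw [integral_indConv hA hB]
    linarith
  obtain ⟨N, hN⟩ : ∃ N : ℕ, (1 - μ.real B + t) ^ 2 ^ N ≤ t := by
    obtain ⟨N, hN⟩ := exists_pow_lt_of_lt_one ht (show 1 - μ.real B + t < 1 by linarith)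
    exact ⟨N, (pow_le_pow_of_le_one (by linarith) (by linarith) Nat.lt_two_pow_self.le).trans hN.le⟩
  have hq0 : (0 : ℝ) ≤ 1 - (1 / 2) ^ N := by
    have : (1 / 2 : ℝ) ^ N ≤ 1 := pow_le_one₀ (by norm_num) (by norm_num)
    linarith
  have hq1 : (1 : ℝ) - (1 / 2) ^ N < 1 := by
    have : (0 : ℝ) < (1 / 2) ^ N := by positivity
    linarith
  have iter : ∀ j : ℕ, ∀ A, MeasurableSet A → t ≤ μ.real A → μ.real A ≤ 1 - μ.real B + t →
      (1 - (1 / 2 : ℝ) ^ N) ^ j * (-1) ≤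
        truncConv μ t A B - t * (μ.real A + μ.real B - t) := by
    intro j
    induction j with
    | zero =>
      intro A hA h1 h2
      have : 0 ≤ truncConv μ t A B := integral_nonneg fun x => le_min (indConv_nonneg x) ht.le
      nlinarith
    | succ j ih =>
      intro A hA h1 h2
      rw [pow_succ', mul_assoc]
      refine le_truncConv_sub_of_pow_le ht.le (by nlinarith [pow_nonneg hq0 j]) hB ih N A hA h1 h2 ?_
      exact (pow_le_pow_left₀ measureReal_nonneg h2 _).trans hN
  have hlim : Filter.Tendsto (fun j : ℕ => (1 - (1 / 2 : ℝ) ^ N) ^ j * (-1)) Filter.atTop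
      (nhds 0) := by
    simpa using (tendsto_pow_atTop_nhds_zero_of_lt_one hq0 hq1).mul_const (-1)
  linarith [le_of_tendsto' hlim fun j => iter j A hA htA hc]

end Pollard

section Profile

variable {H h h' w : ℝ → ℝ}

lemma integral_id_mul (hh : ∀ t, HasDerivAt h (h' t) t) (hh' : ∀ t, HasDerivAt h' (-w t) t)
    (hw : Continuous w) (h0 : h 0 = 0) (s : ℝ) :
    ∫ t in (0 : ℝ)..s, t * w t = h s - s * h' s := by
  have hderiv : ∀ t, HasDerivAt (fun t => h t - t * h' t) (t * w t) t := fun t => by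
    exact ((hh t).fun_sub ((hasDerivAt_id' t).fun_mul (hh' t))).congr_deriv (by ring)
  rw [intervalIntegral.integral_eq_sub_of_hasDerivAt (fun t _ => hderiv t)
    (Continuous.intervalIntegrable (by fun_prop) _ _), h0]
  ring

lemma eq_integral_min_mul_add (hh : ∀ t, HasDerivAt h (h' t) t)
    (hh' : ∀ t, HasDerivAt h' (-w t) t) (hw : Continuous w) (h0 : h 0 = 0) {s m : ℝ}
    (hs : 0 ≤ s) (hsm : s ≤ m) :
    h s = (∫ t in (0 : ℝ)..m, min s t * w t) + h' m * s := by
  have hcont : Continuous fun t => min s t * w t := (continuous_const.min continuous_id).mul hw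
  rw [← intervalIntegral.integral_add_adjacent_intervals (hcont.intervalIntegrable 0 s)
    (hcont.intervalIntegrable s m)]
  have e1 : ∫ t in (0 : ℝ)..s, min s t * w t = ∫ t in (0 : ℝ)..s, t * w t :=
    intervalIntegral.integral_congr fun t ht => by
      rw [Set.uIcc_of_le hs] at ht
      simp only [min_eq_right ht.2]
  have e2 : ∫ t in s..m, min s t * w t = ∫ t in s..m, s * w t :=
    intervalIntegral.integral_congr fun t ht => by
      rw [Set.uIcc_of_le hsm] at ht
      simp only [min_eq_left ht.1]
  rw [e1, e2, integral_id_mul hh hh' hw h0 s,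
    intervalIntegral.integral_eq_sub_of_hasDerivAt (f := fun t => -(s * h' t))
    (fun t _ => (((hh' t).const_mul s).fun_neg).congr_deriv (by ring))
    (Continuous.intervalIntegrable (by fun_prop) _ _)]
  ring

lemma integral_mul_min_mul_add (hH : ∀ t, HasDerivAt H (h t) t) (hh : ∀ t, HasDerivAt h (h' t) t)
    (hh' : ∀ t, HasDerivAt h' (-w t) t) (hw : Continuous w) (h0 : h 0 = 0) {a b m : ℝ}
    (hm : (m - a) * (m - b) = 0) (hm1 : a + b - 1 ≤ m) (hm0 : 0 ≤ m) :
    (∫ t in (0 : ℝ)..m, t * min (a + b - t) 1 * w t) + h' m * (a * b) =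
      max 0 (a + b - 1) * h (max 0 (a + b - 1)) + (a + b - 2 * m) * h m +
        2 * (H m - H (max 0 (a + b - 1))) := by
  set s := max 0 (a + b - 1) with hs
  have hs0 : 0 ≤ s := le_max_left _ _
  have hsm : s ≤ m := max_le hm0 hm1
  have hcont : Continuous fun t => t * min (a + b - t) 1 * w t := by fun_prop
  rw [← intervalIntegral.integral_add_adjacent_intervals (hcont.intervalIntegrable 0 s)
    (hcont.intervalIntegrable s m)]
  have e1 : ∫ t in (0 : ℝ)..s, t * min (a + b - t) 1 * w t = ∫ t in (0 : ℝ)..s, t * w t := by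
    rcases max_choice 0 (a + b - 1) with h1 | h1
    · rw [hs, h1]; simp
    · refine intervalIntegral.integral_congr fun t ht => ?_
      rw [Set.uIcc_of_le hs0, hs, h1] at ht
      simp only [min_eq_right (show 1 ≤ a + b - t by linarith [ht.2]), mul_one]
  have e2 : ∫ t in s..m, t * min (a + b - t) 1 * w t = ∫ t in s..m, t * (a + b - t) * w t :=
    intervalIntegral.integral_congr fun t ht => by
      rw [Set.uIcc_of_le hsm] at ht
      have : a + b - 1 ≤ t := (le_max_right _ _).trans ht.1
      simp only [min_eq_left (show a + b - t ≤ 1 by linarith)]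
  rw [e1, e2, integral_id_mul hh hh' hw h0 s,
    intervalIntegral.integral_eq_sub_of_hasDerivAt
      (f := fun t => -(t * (a + b - t) * h' t) + (a + b - 2 * t) * h t + 2 * H t)
    (fun t _ => by
      have d1 : HasDerivAt (fun t : ℝ => t * (a + b - t)) (a + b - 2 * t) t :=
        ((hasDerivAt_id' t).fun_mul ((hasDerivAt_id' t).const_sub (a + b))).congr_deriv (by ring)
      have d2 : HasDerivAt (fun t : ℝ => a + b - 2 * t) (-2) t :=
        (((hasDerivAt_id' t).const_mul 2).const_sub (a + b)).congr_deriv (by ring)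
      exact ((((d1.fun_mul (hh' t)).fun_neg).fun_add (d2.fun_mul (hh t))).fun_add
        ((hH t).const_mul 2)).congr_deriv (by ring))
    (Continuous.intervalIntegrable (by fun_prop) _ _)]
  have hs' : s * (a + b - 1 - s) = 0 := by
    rcases max_choice 0 (a + b - 1) with h1 | h1 <;> rw [hs, h1] <;> ring
  have hs'' : h s * (a + b - 1 - s) = 0 := by
    rcases max_choice 0 (a + b - 1) with h1 | h1 <;> rw [hs, h1]
    · rw [h0, zero_mul]
    · ring
  linear_combination h' s * hs' - hs'' + h' m * hm

variable {G : Type*} [AddCommGroup G] [TopologicalSpace G] [IsTopologicalAddGroup G]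
  [R1Space G] [SecondCountableTopology G] [ConnectedSpace G] [MeasurableSpace G] [BorelSpace G]
  {μ : Measure G} [IsProbabilityMeasure μ] [μ.IsAddLeftInvariant] [μ.IsNegInvariant]
  [μ.InnerRegularCompactLTTop] {A B : Set G}

/-- A lower bound for the integral of a concave function `h` of the convolution of two
indicators, with equality for arcs of the circle. -/
theorem le_integral_comp_indConv (hA : MeasurableSet A) (hB : MeasurableSet B)
    (hH : ∀ t, HasDerivAt H (h t) t) (hh : ∀ t, HasDerivAt h (h' t) t)
    (hh' : ∀ t, HasDerivAt h' (-w t) t) (hw : Continuous w)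
    (hw0 : ∀ t, 0 ≤ t → t ≤ μ.real B → 0 ≤ w t) (h0 : h 0 = 0) {m s : ℝ}
    (hm : m = min (μ.real A) (μ.real B)) (hs : s = max 0 (μ.real A + μ.real B - 1)) :
    s * h s + (μ.real A + μ.real B - 2 * m) * h m + 2 * (H m - H s) ≤
      ∫ x, h (indConv μ A B x) ∂μ := by
  have hA1 : μ.real A ≤ 1 := measureReal_le_one
  have hB1 : μ.real B ≤ 1 := measureReal_le_one
  have hm0 : 0 ≤ m := hm ▸ le_min measureReal_nonneg measureReal_nonneg
  have hmA : m ≤ μ.real A := hm ▸ min_le_left _ _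
  have hmB : m ≤ μ.real B := hm ▸ min_le_right _ _
  have hint : Integrable (Function.uncurry fun (t : ℝ) (x : G) => min (indConv μ A B x) t * w t)
      ((volume.restrict (Set.uIoc 0 m)).prod μ) := by
    have hmeas : Measurable (indConv μ A B) := measurable_indConv hA hB
    refine Integrable.mono' (g := fun p => (1 + |p.1|) * |w p.1|) ?_ ?_ (.of_forall ?_)
    · have : Continuous fun t : ℝ => (1 + |t|) * |w t| := by fun_prop
      exact Integrable.comp_fst
        (intervalIntegrable_iff.1 (this.intervalIntegrable 0 m)) μ
    · exact (((hmeas.comp measurable_snd).min measurable_fst).mul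
        (hw.measurable.comp measurable_fst)).aestronglyMeasurable
    · rintro ⟨t, x⟩
      simp only [Function.uncurry_apply_pair, norm_mul, Real.norm_eq_abs]
      gcongr
      have h1 := indConv_nonneg (μ := μ) (A := A) (B := B) x
      have h2 : indConv μ A B x ≤ 1 := measureReal_le_one
      grind
  have hswap := intervalIntegral_integral_swap hint
  have hkey : ∫ x, h (indConv μ A B x) ∂μ =
      (∫ t in (0 : ℝ)..m, truncConv μ t A B * w t) + h' m * (μ.real A * μ.real B) := by
    have h1 : ∀ x, h (indConv μ A B x) =
        (∫ t in (0 : ℝ)..m, min (indConv μ A B x) t * w t) + h' m * indConv μ A B x := fun x =>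
      eq_integral_min_mul_add hh hh' hw h0 (indConv_nonneg x)
        (hm ▸ le_min (indConv_le_left hA x) (indConv_le_right x))
    simp_rw [h1]
    rw [integral_add _ ((integrable_indConv hA hB).const_mul _), ← hswap, integral_const_mul,
      integral_indConv hA hB]
    · simp only [integral_mul_const, truncConv]
    · simp only [intervalIntegral.integral_of_le hm0]
      rw [Set.uIoc_of_le hm0] at hint
      exact hint.integral_prod_right
  rw [hkey, hs,
    ← integral_mul_min_mul_add hH hh hh' hw h0 (a := μ.real A) (b := μ.real B) ?_ ?_ hm0]
  · gcongr
    refine intervalIntegral.integral_mono_on hm0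
      (Continuous.intervalIntegrable (by fun_prop) _ _) ?_ fun t ht => ?_
    · rw [intervalIntegrable_iff]
      have := hint.integral_prod_left
      simpa only [Function.uncurry_apply_pair, integral_mul_const, truncConv, IntegrableOn] using this
    · exact mul_le_mul_of_nonneg_right (mul_min_le_truncConv hA hB ht.1 (ht.2.trans hmA)
        (ht.2.trans hmB)) (hw0 t ht.1 (ht.2.trans hmB))
  · rcases min_choice (μ.real A) (μ.real B) with h1 | h1 <;> rw [hm, h1] <;> ring
  · rcases min_choice (μ.real A) (μ.real B) with h1 | h1 <;> rw [hm, h1] <;> linarith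

theorem le_integral_one_sub_pow (hA : MeasurableSet A) (hB : MeasurableSet B)
    (hB0 : 0 < μ.real B) (k : ℕ) {m s : ℝ}
    (hm : m = min (μ.real A) (μ.real B)) (hs : s = max 0 (μ.real A + μ.real B - 1)) :
    s * (1 - (1 - s / μ.real B) ^ (k + 1)) +
      (μ.real A + μ.real B - 2 * m) * (1 - (1 - m / μ.real B) ^ (k + 1)) +
      2 * ((m + μ.real B / (k + 2) * (1 - m / μ.real B) ^ (k + 2)) -
        (s + μ.real B / (k + 2) * (1 - s / μ.real B) ^ (k + 2))) ≤
      ∫ x, (1 - (1 - indConv μ A B x / μ.real B) ^ (k + 1)) ∂μ := by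
  set b := μ.real B with hb
  have hlin : ∀ t, HasDerivAt (fun t => 1 - t / b) (-(1 / b)) t := fun t => by
    simpa using ((hasDerivAt_id t).div_const b).const_sub 1
  have hpow : ∀ (j : ℕ) t, HasDerivAt (fun t => (1 - t / b) ^ j)
      (j * (1 - t / b) ^ (j - 1) * -(1 / b)) t := fun j t => (hlin t).pow j
  refine le_integral_comp_indConv (H := fun t => t + b / (k + 2) * (1 - t / b) ^ (k + 2))
    (h := fun t => 1 - (1 - t / b) ^ (k + 1)) (h' := fun t => (k + 1) / b * (1 - t / b) ^ k)
    (w := fun t => (k + 1) * k / b ^ 2 * (1 - t / b) ^ (k - 1)) hA hB ?_ ?_ ?_ (by fun_prop) ?_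
    (by simp) hm hs
  · intro t
    refine ((hasDerivAt_id' t).fun_add
      ((hpow (k + 2) t).const_mul (b / (k + 2)))).congr_deriv ?_
    rw [show k + 2 - 1 = k + 1 from rfl]
    have : (k : ℝ) + 2 ≠ 0 := by positivity
    push_cast
    field_simp
    ring
  · intro t
    refine ((hpow (k + 1) t).const_sub 1).congr_deriv ?_
    rw [show k + 1 - 1 = k from rfl]
    push_cast
    ring
  · intro t
    exact ((hpow k t).const_mul ((k + 1) / b)).congr_deriv (by ring)
  · intro t _ ht
    have : 0 ≤ 1 - t / b := sub_nonneg.2 ((div_le_one hB0).2 ht)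
    positivity

end Profile

/-- The total measure of random translates, as an integral of the convolution. -/
lemma toReal_lintegral_iUnion {G : Type*} [AddCommGroup G] [MeasurableSpace G] [MeasurableAdd₂ G]
    [MeasurableNeg G] {μ : Measure G} [IsProbabilityMeasure μ] {A B : Set G}
    (hA : MeasurableSet A) (n : ℕ) :
    (∫⁻ b in Set.univ.pi fun _ : Fin n => B, μ (⋃ i, (· + b i) '' A)
      ∂(Measure.pi fun _ => μ)).toReal =
      ∫ x, (μ.real B ^ n - (μ.real B - indConv μ A B x) ^ n) ∂μ := by
  rw [Measure.restrict_pi_pi]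
  set ν : Measure (Fin n → G) := Measure.pi fun _ => μ.restrict B with hν
  have hS : MeasurableSet {p : (Fin n → G) × G | ∃ i, p.2 - p.1 i ∈ A} := by
    rw [Set.ofPred_exists]
    refine .iUnion fun i => ?_
    have : Measurable fun p : (Fin n → G) × G => p.2 - p.1 i := by fun_prop
    exact this hA
  have h1 := Measure.prod_apply (μ := ν) (ν := μ) hS
  rw [Measure.prod_apply_symm hS] at h1
  have h2 : ∀ b : Fin n → G, (⋃ i, (· + b i) '' A) =
      Prod.mk b ⁻¹' {p : (Fin n → G) × G | ∃ i, p.2 - p.1 i ∈ A} := by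
    intro b
    ext x
    simp [sub_eq_add_neg]
  simp_rw [h2]
  rw [← h1, ← integral_toReal (measurable_measure_prodMk_right hS).aemeasurable
    (.of_forall fun _ => measure_lt_top _ _)]
  congr 1 with x
  have h3 : (fun b : Fin n → G => (b, x)) ⁻¹' {p : (Fin n → G) × G | ∃ i, p.2 - p.1 i ∈ A} =
      (Set.univ.pi fun _ => ((fun b => x - b) ⁻¹' A)ᶜ)ᶜ := by
    ext b
    simp
  have hm := measurableSet_sub_preimage hA x
  have h4 : μ.real (B \ (fun b => x - b) ⁻¹' A) = μ.real B - indConv μ A B x := by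
    have := measureReal_sdiff_add_inter (μ := μ) (s := B) hm
    simp only [indConv]
    linarith
  rw [← measureReal_def, h3, measureReal_compl (.univ_pi fun _ => hm.compl), ← h4]
  simp only [measureReal_def, hν, Measure.pi_univ, Measure.pi_pi, Measure.restrict_apply hm.compl,
    Measure.restrict_apply_univ, Finset.prod_const, Finset.card_univ, Fintype.card_fin,
    ENNReal.toReal_pow, Set.sdiff_eq, Set.inter_comm]

instance : IsProbabilityMeasure (volume : Measure 𝕋) := ⟨UnitAddCircle.measure_univ⟩

instance (d : ℕ) : (volume : Measure (Fin d → 𝕋)).IsNegInvariant :=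
  Measure.pi.isNegInvariant _

theorem expUnionT_const (d n : ℕ) {A B : Set (Fin d → 𝕋)} (hA : MeasurableSet A)
    (hB0 : 0 < volume B) :
    expUnionT (fun _ : Fin n => A) (fun _ => B) =
      ∫ x, (1 - (1 - indConv volume A B x / volume.real B) ^ n) := by
  have hb : volume.real B ≠ 0 := (ENNReal.toReal_pos hB0.ne' (measure_ne_top _ _)).ne'
  rw [expUnionT, ENNReal.toReal_mul, volume_pi (ι := Fin n),
    toReal_lintegral_iUnion (μ := (volume : Measure (Fin d → 𝕋))) hA n, ← integral_const_mul]
  congr 1 with x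
  rw [Finset.prod_const, Finset.card_univ, Fintype.card_fin, ENNReal.toReal_inv,
    ENNReal.toReal_pow, ← measureReal_def, one_sub_div hb, div_pow]
  field_simp

theorem stmt3 (d n : ℕ) (hn : 1 ≤ n)
    (A B : Set (Fin (d + 1) → 𝕋)) (hAm : MeasurableSet A) (hBm : MeasurableSet B)
    (hA0 : 0 < volume A) (hB0 : 0 < volume B) :
    ((volume A).toReal + (volume B).toReal ≤ 1 →
      expUnionT (fun _ : Fin n => A) (fun _ => B) ≥
        (volume A).toReal + ((n : ℝ) - 1) / ((n : ℝ) + 1) * (volume B).toReal -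
          ((n : ℝ) - 1) / ((n : ℝ) + 1) * (volume B).toReal *
            (1 - (volume A).toReal / (volume B).toReal) ^ (n + 1) *
            (if volume A < volume B then 1 else 0)) ∧
    (1 < (volume A).toReal + (volume B).toReal →
      expUnionT (fun _ : Fin n => A) (fun _ => B) ≥
        1 - ((1 - (volume A).toReal) / (volume B).toReal) ^ n *
              ((volume B).toReal - ((n : ℝ) - 1) / ((n : ℝ) + 1) * (1 - (volume A).toReal)) -
          ((n : ℝ) - 1) / ((n : ℝ) + 1) * (volume B).toReal *
            (1 - (volume A).toReal / (volume B).toReal) ^ (n + 1) *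
            (if volume A < volume B then 1 else 0)) := by
  have hb : 0 < volume.real B := ENNReal.toReal_pos hB0.ne' (measure_ne_top _ _)
  have hA1 : volume.real A ≤ 1 := measureReal_le_one
  have hB1 : volume.real B ≤ 1 := measureReal_le_one
  obtain ⟨k, rfl⟩ : ∃ k, n = k + 1 := ⟨n - 1, by omega⟩
  have key := le_integral_one_sub_pow (μ := (volume : Measure (Fin (d + 1) → 𝕋))) hAm hBm hb k
    rfl rfl
  rw [← expUnionT_const _ _ hAm hB0] at key
  have hlt : volume A < volume B ↔ volume.real A < volume.real B :=
    (ENNReal.toReal_lt_toReal (measure_ne_top _ _) (measure_ne_top _ _)).symm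
  simp only [← measureReal_def, hlt]
  generalize expUnionT (fun _ : Fin (k + 1) => A) (fun _ => B) = E at *
  generalize volume.real A = a at *
  generalize volume.real B = b at *
  have hn2 : ((k + 1 : ℕ) : ℝ) + 1 = k + 2 := by push_cast; ring
  have hfrac : (((k + 1 : ℕ) : ℝ) - 1) / (((k + 1 : ℕ) : ℝ) + 1) = 1 - 2 * (k + 2 : ℝ)⁻¹ := by
    rw [hn2]
    push_cast
    field_simp
    ring
  rw [hfrac]
  rw [div_eq_mul_inv b (k + 2 : ℝ)] at key
  generalize (k + 2 : ℝ)⁻¹ = c at *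
  have hq : b - a = b * (1 - a / b) := by field_simp
  have hr : b * ((1 - a) / b) = 1 - a := by field_simp
  have hs : 1 - (a + b - 1) / b = (1 - a) / b := by field_simp; ring
  constructor
  · intro hab
    rw [max_eq_left (by linarith), zero_div, sub_zero, one_pow, one_pow] at key
    refine le_of_eq_of_le ?_ key
    split_ifs with h
    · rw [min_eq_left h.le]
      generalize 1 - a / b = q at *
      linear_combination q ^ (k + 1) * hq
    · rw [min_eq_right (not_lt.1 h), div_self hb.ne', sub_self, zero_pow (by omega),
        zero_pow (by omega)]
      ring
  · intro hab
    rw [max_eq_right (by linarith), hs] at key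
    refine le_of_eq_of_le ?_ key
    generalize (1 - a) / b = r at *
    split_ifs with h
    · rw [min_eq_left h.le]
      generalize 1 - a / b = q at *
      linear_combination q ^ (k + 1) * hq + 2 * c * r ^ (k + 1) * hr
    · rw [min_eq_right (not_lt.1 h), div_self hb.ne', sub_self, zero_pow (by omega),
        zero_pow (by omega)]
      linear_combination 2 * c * r ^ (k + 1) * hr
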